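/- Let X₁, X₂, X₃, X₄ be complex-valued random variables on a probability space (Ω, P) such that the law (pushforward of P) of the ℝ⁸-valued random vector (Re X₁, Re X₂, Re X₃, Re X₄, Im X₁, Im X₂, Im X₃, Im X₄) is a centered Gaussian measure on ℝ⁸, and suppose moreover that E(Xᵢ·Xⱼ) = 0 for all 1 ≤ i, j ≤ 4 (complex symmetry). Then E(X₁·conj(X₂)·conj(X₃)·X₄) = E(X₁·conj(X₂))·E(conj(X₃)·X₄) + E(X₁·conj(X₃))·E(conj(X₂)·X₄). -/

import Mathlib

open MeasureTheory ProbabilityTheory ComplexConjugate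

/-- A measure on `ℝⁿ` is centered Gaussian if every one-dimensional pushforward by a
linear functional is a centered Gaussian distribution on `ℝ`. -/
def IsCenteredGaussianRV {n : ℕ} (μ : Measure (Fin n → ℝ)) : Prop :=
  ∀ L : (Fin n → ℝ) →ₗ[ℝ] ℝ, ∃ v : NNReal, μ.map L = gaussianReal 0 v

open scoped NNReal

lemma integral_sq_gaussianReal_zero (v : ℝ≥0) : ∫ x, x ^ 2 ∂gaussianReal 0 v = v := by
  have h := variance_fun_id_gaussianReal (μ := 0) (v := v)
  rw [variance_eq_integral measurable_id'.aemeasurable] at h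
  simpa using h

lemma integral_pow_four_gaussianReal_zero (v : ℝ≥0) :
    ∫ x, x ^ 4 ∂gaussianReal 0 v = 3 * (v : ℝ) ^ 2 := by
  have hmgf : ∫ x, x ^ 4 ∂gaussianReal 0 v
      = iteratedDeriv 4 (mgf (fun x ↦ x) (gaussianReal 0 v)) 0 := by
    rw [iteratedDeriv_mgf_zero] <;> simp
  have hexp (t : ℝ) : HasDerivAt (fun t : ℝ ↦ Real.exp (v * t ^ 2 / 2))
      (Real.exp (v * t ^ 2 / 2) * (v * t)) t := by
    refine ((((hasDerivAt_id t).pow 2).const_mul (v : ℝ)).div_const 2).exp.congr_deriv ?_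
    simp
    ring
  have h1 : deriv (fun t : ℝ ↦ Real.exp (v * t ^ 2 / 2))
      = fun t ↦ Real.exp (v * t ^ 2 / 2) * (v * t) := funext fun t ↦ (hexp t).deriv
  have h2 : deriv (fun t : ℝ ↦ Real.exp (v * t ^ 2 / 2) * (v * t))
      = fun t ↦ Real.exp (v * t ^ 2 / 2) * (v + v ^ 2 * t ^ 2) := by
    funext t
    refine (((hexp t).mul ((hasDerivAt_id t).const_mul (v : ℝ))).congr_deriv ?_).deriv
    simp
    ring
  have h3 : deriv (fun t : ℝ ↦ Real.exp (v * t ^ 2 / 2) * (v + v ^ 2 * t ^ 2))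
      = fun t ↦ Real.exp (v * t ^ 2 / 2) * (3 * v ^ 2 * t + v ^ 3 * t ^ 3) := by
    funext t
    refine (((hexp t).mul ((((hasDerivAt_id t).pow 2).const_mul ((v : ℝ) ^ 2)).const_add
      (v : ℝ))).congr_deriv ?_).deriv
    simp
    ring
  have h4 : deriv (fun t : ℝ ↦ Real.exp (v * t ^ 2 / 2) * (3 * v ^ 2 * t + v ^ 3 * t ^ 3)) 0
      = 3 * (v : ℝ) ^ 2 := by
    refine (((hexp 0).mul (((hasDerivAt_id (0 : ℝ)).const_mul (3 * (v : ℝ) ^ 2)).add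
      (((hasDerivAt_id (0 : ℝ)).pow 3).const_mul ((v : ℝ) ^ 3)))).congr_deriv ?_).deriv
    simp
  rw [hmgf, mgf_fun_id_gaussianReal]
  simp only [zero_mul, zero_add, iteratedDeriv_succ, iteratedDeriv_zero, h1, h2, h3, h4]

namespace IsCenteredGaussianRV

variable {n : ℕ} {μ : Measure (Fin n → ℝ)}

lemma isProbabilityMeasure (hμ : IsCenteredGaussianRV μ) : IsProbabilityMeasure μ := by
  obtain ⟨v, hv⟩ := hμ 0
  have : IsProbabilityMeasure (μ.map (0 : (Fin n → ℝ) →ₗ[ℝ] ℝ)) := by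
    rw [hv]; infer_instance
  exact Measure.isProbabilityMeasure_of_map (⇑(0 : (Fin n → ℝ) →ₗ[ℝ] ℝ))

lemma memLp_real (hμ : IsCenteredGaussianRV μ) (L : (Fin n → ℝ) →ₗ[ℝ] ℝ) : MemLp L 4 μ := by
  obtain ⟨v, hv⟩ := hμ L
  have hL : AEMeasurable L μ := L.continuous_of_finiteDimensional.aemeasurable
  have h : MemLp id 4 (μ.map L) := by
    rw [hv]
    exact memLp_id_gaussianReal' 4 (by norm_num)
  exact (memLp_map_measure_iff (by fun_prop) hL).1 h

lemma integral_pow_four_real (hμ : IsCenteredGaussianRV μ) (L : (Fin n → ℝ) →ₗ[ℝ] ℝ) :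
    ∫ x, L x ^ 4 ∂μ = 3 * (∫ x, L x ^ 2 ∂μ) ^ 2 := by
  obtain ⟨v, hv⟩ := hμ L
  have hL : AEMeasurable L μ := L.continuous_of_finiteDimensional.aemeasurable
  rw [← integral_map (f := fun y : ℝ ↦ y ^ 4) hL (by fun_prop),
    ← integral_map (f := fun y : ℝ ↦ y ^ 2) hL (by fun_prop), hv,
    integral_pow_four_gaussianReal_zero, integral_sq_gaussianReal_zero]

lemma memLp (hμ : IsCenteredGaussianRV μ) (f : (Fin n → ℝ) →ₗ[ℝ] ℂ) : MemLp f 4 μ :=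
  memLp_re_im_iff.1 ⟨hμ.memLp_real (Complex.reLm ∘ₗ f), hμ.memLp_real (Complex.imLm ∘ₗ f)⟩

lemma integrable_mul (hμ : IsCenteredGaussianRV μ) (f g : (Fin n → ℝ) →ₗ[ℝ] ℂ) :
    Integrable (fun x ↦ f x * g x) μ := by
  have := hμ.isProbabilityMeasure
  exact ((hμ.memLp f).mono_exponent (p := 2) (by norm_num)).integrable_mul
    ((hμ.memLp g).mono_exponent (p := 2) (by norm_num))

lemma integrable_pow_four (hμ : IsCenteredGaussianRV μ) (f : (Fin n → ℝ) →ₗ[ℝ] ℂ) :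
    Integrable (fun x ↦ f x ^ 4) μ := by
  have hf : Continuous f := f.continuous_of_finiteDimensional
  refine (integrable_norm_iff (by fun_prop)).1 ?_
  simpa using (hμ.memLp f).integrable_norm_pow (p := 4) (by norm_num)

/-- The complex bilinear second moment form `(f, g) ↦ E[f g]` of a centered Gaussian measure. -/
noncomputable def secondMoment (hμ : IsCenteredGaussianRV μ) :
    ((Fin n → ℝ) →ₗ[ℝ] ℂ) →ₗ[ℂ] ((Fin n → ℝ) →ₗ[ℝ] ℂ) →ₗ[ℂ] ℂ :=
  LinearMap.mk₂ ℂ (fun f g ↦ ∫ x, f x * g x ∂μ)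
    (fun f f' g ↦ by
      simp only [LinearMap.add_apply, add_mul]
      exact integral_add (hμ.integrable_mul f g) (hμ.integrable_mul f' g))
    (fun c f g ↦ by simp [mul_assoc, integral_const_mul])
    (fun f g g' ↦ by
      simp only [LinearMap.add_apply, mul_add]
      exact integral_add (hμ.integrable_mul f g) (hμ.integrable_mul f g'))
    (fun c f g ↦ by simp [mul_left_comm, integral_const_mul])

lemma secondMoment_apply (hμ : IsCenteredGaussianRV μ) (f g : (Fin n → ℝ) →ₗ[ℝ] ℂ) :
    hμ.secondMoment f g = ∫ x, f x * g x ∂μ := rfl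

lemma secondMoment_comm (hμ : IsCenteredGaussianRV μ) (f g : (Fin n → ℝ) →ₗ[ℝ] ℂ) :
    hμ.secondMoment f g = hμ.secondMoment g f := by
  simp only [secondMoment_apply, mul_comm]

lemma integral_sum_mul_pow_four (hμ : IsCenteredGaussianRV μ) {m : ℕ} (c : Fin m → ℂ)
    (f : Fin m → (Fin n → ℝ) →ₗ[ℝ] ℂ) :
    ∫ x, ∑ i, c i * f i x ^ 4 ∂μ = ∑ i, c i * ∫ x, f i x ^ 4 ∂μ := by
  rw [integral_finsetSum _ fun i _ ↦ (hμ.integrable_pow_four (f i)).const_mul (c i)]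
  simp only [integral_const_mul]

lemma integral_pow_four_ofReal (hμ : IsCenteredGaussianRV μ) (L : (Fin n → ℝ) →ₗ[ℝ] ℝ) :
    ∫ x, (Complex.ofRealCLM.toLinearMap ∘ₗ L) x ^ 4 ∂μ =
      3 * hμ.secondMoment (Complex.ofRealCLM.toLinearMap ∘ₗ L)
        (Complex.ofRealCLM.toLinearMap ∘ₗ L) ^ 2 := by
  have h := congrArg ((↑) : ℝ → ℂ) (hμ.integral_pow_four_real L)
  push_cast [← integral_complex_ofReal] at h
  simpa [secondMoment_apply, ← sq] using h

lemma integral_pow_four (hμ : IsCenteredGaussianRV μ) (f : (Fin n → ℝ) →ₗ[ℝ] ℂ) :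
    ∫ x, f x ^ 4 ∂μ = 3 * hμ.secondMoment f f ^ 2 := by
  set u : (Fin n → ℝ) →ₗ[ℝ] ℂ := Complex.ofRealCLM.toLinearMap ∘ₗ Complex.reLm ∘ₗ f with hu
  set w : (Fin n → ℝ) →ₗ[ℝ] ℂ := Complex.ofRealCLM.toLinearMap ∘ₗ Complex.imLm ∘ₗ f with hw
  have hf : f = u + Complex.I • w := by
    refine LinearMap.ext fun x ↦ ?_
    simp [hu, hw, mul_comm Complex.I, Complex.re_add_im]
  have key (t : ℝ) : ∫ x, (u + (t : ℂ) • w) x ^ 4 ∂μ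
      = 3 * hμ.secondMoment (u + (t : ℂ) • w) (u + (t : ℂ) • w) ^ 2 := by
    have : u + (t : ℂ) • w =
        Complex.ofRealCLM.toLinearMap ∘ₗ (Complex.reLm ∘ₗ f + t • (Complex.imLm ∘ₗ f)) := by
      refine LinearMap.ext fun x ↦ ?_
      simp [hu, hw]
    rw [this, integral_pow_four_ofReal]
  -- Lagrange interpolation at the nodes `0, 1, -1, 2, -2`, evaluated at `I`
  let c : Fin 5 → ℂ := ![5 / 2, 5 * (Complex.I - 1) / 6, 5 * (-Complex.I - 1) / 6,
    (1 - 2 * Complex.I) / 12, (1 + 2 * Complex.I) / 12]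
  let t : Fin 5 → ℝ := ![0, 1, -1, 2, -2]
  have hI2 := Complex.I_sq
  have hI4 : Complex.I ^ 4 = 1 := Complex.I_pow_four
  have hI3 : Complex.I ^ 3 = -Complex.I := Complex.I_pow_three
  have hint : ∫ x, f x ^ 4 ∂μ = ∑ i, c i * ∫ x, (u + (t i : ℂ) • w) x ^ 4 ∂μ := by
    rw [← hμ.integral_sum_mul_pow_four]
    congr 1 with x
    rw [hf]
    simp only [Fin.sum_univ_five, c, t, LinearMap.add_apply, LinearMap.smul_apply, smul_eq_mul]
    simp
    ring_nf
    simp only [hI2, hI3, hI4]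
    ring
  rw [hint]
  simp only [key]
  rw [hf]
  simp only [map_add, map_smul, LinearMap.add_apply, LinearMap.smul_apply, smul_eq_mul,
    hμ.secondMoment_comm w u]
  generalize hμ.secondMoment u u = a
  generalize hμ.secondMoment u w = b
  generalize hμ.secondMoment w w = d
  simp only [Fin.sum_univ_five, c, t]
  simp
  ring_nf
  simp only [hI2, hI3, hI4]
  ring

/-- Isserlis' (Wick's) formula for four complex linear functionals. -/
theorem integral_mul_mul_mul (hμ : IsCenteredGaussianRV μ)
    (f g h k : (Fin n → ℝ) →ₗ[ℝ] ℂ) :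
    ∫ x, f x * g x * h x * k x ∂μ =
      (∫ x, f x * g x ∂μ) * (∫ x, h x * k x ∂μ) + (∫ x, f x * h x ∂μ) * (∫ x, g x * k x ∂μ) +
        (∫ x, f x * k x ∂μ) * (∫ x, g x * h x ∂μ) := by
  let c : Fin 8 → ℂ := ![1 / 192, -1 / 192, -1 / 192, -1 / 192, 1 / 192, 1 / 192, 1 / 192,
    -1 / 192]
  let F : Fin 8 → (Fin n → ℝ) →ₗ[ℝ] ℂ := ![f + g + h + k, f - g + h + k, f + g - h + k,
    f + g + h - k, f - g - h + k, f - g + h - k, f + g - h - k, f - g - h - k]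
  have hint : ∫ x, f x * g x * h x * k x ∂μ = ∑ i, c i * ∫ x, F i x ^ 4 ∂μ := by
    rw [← hμ.integral_sum_mul_pow_four]
    congr 1 with x
    simp [Fin.sum_univ_eight, c, F]
    ring
  rw [hint]
  simp only [hμ.integral_pow_four, ← hμ.secondMoment_apply]
  simp only [Fin.sum_univ_eight, c, F, Matrix.cons_val]
  simp only [map_add, map_sub, LinearMap.add_apply, LinearMap.sub_apply,
    hμ.secondMoment_comm g f, hμ.secondMoment_comm h f, hμ.secondMoment_comm k f,
    hμ.secondMoment_comm h g, hμ.secondMoment_comm k g, hμ.secondMoment_comm k h]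
  ring

end IsCenteredGaussianRV

theorem stmt0 {Ω : Type} [MeasurableSpace Ω] (P : Measure Ω) [IsProbabilityMeasure P]
    (X : Fin 4 → Ω → ℂ)
    (hGauss : IsCenteredGaussianRV (P.map fun ω =>
      Fin.append (fun i => (X i ω).re) (fun i => (X i ω).im)))
    (hSym : ∀ i j : Fin 4, ∫ ω, X i ω * X j ω ∂P = 0) :
    ∫ ω, X 0 ω * conj (X 1 ω) * conj (X 2 ω) * X 3 ω ∂P =
      (∫ ω, X 0 ω * conj (X 1 ω) ∂P) * (∫ ω, conj (X 2 ω) * X 3 ω ∂P) +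
      (∫ ω, X 0 ω * conj (X 2 ω) ∂P) * (∫ ω, conj (X 1 ω) * X 3 ω ∂P) := by
  set Y : Ω → Fin (4 + 4) → ℝ := fun ω ↦
    Fin.append (fun i => (X i ω).re) (fun i => (X i ω).im) with hY
  have hYm : AEMeasurable Y P := by
    have := hGauss.isProbabilityMeasure
    exact AEMeasurable.of_map_ne_zero (NeZero.ne _)
  let Z (i : Fin 4) : (Fin (4 + 4) → ℝ) →ₗ[ℝ] ℂ :=
    Complex.ofRealCLM.toLinearMap ∘ₗ LinearMap.proj (Fin.castAdd 4 i) +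
      Complex.I • (Complex.ofRealCLM.toLinearMap ∘ₗ LinearMap.proj (Fin.natAdd 4 i))
  let Zc (i : Fin 4) : (Fin (4 + 4) → ℝ) →ₗ[ℝ] ℂ := Complex.conjAe.toLinearMap ∘ₗ Z i
  have hZ (i : Fin 4) (ω : Ω) : Z i (Y ω) = X i ω := by
    simp [Z, hY, mul_comm Complex.I, -Fin.natAdd_eq_addNat, Complex.re_add_im]
  have hZc (i : Fin 4) (ω : Ω) : Zc i (Y ω) = conj (X i ω) := by
    simp [Zc, hZ]
  have hcont (f : (Fin (4 + 4) → ℝ) →ₗ[ℝ] ℂ) : Continuous f := f.continuous_of_finiteDimensional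
  have htwo (f g : (Fin (4 + 4) → ℝ) →ₗ[ℝ] ℂ) :
      ∫ y, f y * g y ∂P.map Y = ∫ ω, f (Y ω) * g (Y ω) ∂P :=
    integral_map hYm ((hcont f).mul (hcont g)).aestronglyMeasurable
  have hfour (f g h k : (Fin (4 + 4) → ℝ) →ₗ[ℝ] ℂ) :
      ∫ y, f y * g y * h y * k y ∂P.map Y = ∫ ω, f (Y ω) * g (Y ω) * h (Y ω) * k (Y ω) ∂P :=
    integral_map hYm
      ((((hcont f).mul (hcont g)).mul (hcont h)).mul (hcont k)).aestronglyMeasurable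
  have hwick := hGauss.integral_mul_mul_mul (Z 0) (Zc 1) (Zc 2) (Z 3)
  simp only [htwo, hfour, hZ, hZc, hSym 0 3, zero_mul, add_zero] at hwick
  exact hwick
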